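/- ℤ^{N-1} is the disjoint union of the sets S_ω over ω ∈ W_0: every a ∈ ℤ^{N-1} lies in S_ω for exactly one ω ∈ W_0. -/

import Mathlib

open Matrix

noncomputable section

namespace IH

variable (p : ℕ) [Fact p.Prime]

/-- `\bar{𝔽}_p`, an algebraic closure of the residue field. -/
abbrev kb := AlgebraicClosure (ZMod p)

variable (N : ℕ)

/-- `G = GL_N(F)` with `F = ℚ_p`. -/
abbrev GG := GL (Fin N) ℚ_[p]
/-- `GL_N(O_F)` (as an abstract group, mapping onto `K ⊆ G`). -/
abbrev MM := GL (Fin N) ℤ_[p]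
/-- `GL_N(k_F)`. -/
abbrev Gk := GL (Fin N) (ZMod p)

/-- The inclusion `GL_N(O_F) → GL_N(F)`. -/
def iotaM : MM p N →* GG p N := Matrix.GeneralLinearGroup.map (PadicInt.Coe.ringHom)

/-- The reduction map `red : GL_N(O_F) → GL_N(k_F)`. -/
def redM : MM p N →* Gk p N := Matrix.GeneralLinearGroup.map (PadicInt.toZMod)

/-- Elements of `GL_N(O_F)` whose reduction is upper triangular: the Iwahori condition. -/
def Ipre : Set (MM p N) :=
  {m | ∀ i j : Fin N, j < i → ((redM p N m : Matrix (Fin N) (Fin N) (ZMod p)) i j = 0)}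

/-- Elements of `GL_N(O_F)` whose reduction is upper triangular unipotent: pro-p Iwahori. -/
def I1pre : Set (MM p N) :=
  {m | m ∈ Ipre p N ∧ ∀ i : Fin N, ((redM p N m : Matrix (Fin N) (Fin N) (ZMod p)) i i = 1)}

/-- Elements of `GL_N(O_F)` reducing to the identity: `K_1 = ker red`. -/
def K1pre : Set (MM p N) := {m | redM p N m = 1}

/-- `K = GL_N(O_F)` as a subset of `G`. -/
def Kset : Set (GG p N) := Set.range (iotaM p N)
/-- The Iwahori subgroup `I ⊆ G`. -/
def Iset : Set (GG p N) := iotaM p N '' Ipre p N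
/-- The pro-p Iwahori subgroup `I_1 ⊆ G`. -/
def I1set : Set (GG p N) := iotaM p N '' I1pre p N
/-- `K_1 ⊆ G`. -/
def K1set : Set (GG p N) := iotaM p N '' K1pre p N

/-- The uniformizer `ϖ = p` as a unit of `ℚ_p`. -/
def pU : ℚ_[p]ˣ :=
  Units.mk0 (p : ℚ_[p]) (by
    have h := (Fact.out : p.Prime).ne_zero
    exact_mod_cast Nat.cast_ne_zero.mpr h)

/-- Scalar matrices as elements of `G`. -/
def scalarGL (u : ℚ_[p]ˣ) : GG p N :=
  Units.map (algebraMap ℚ_[p] (Matrix (Fin N) (Fin N) ℚ_[p])).toMonoidHom u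

/-- The central element `ϖ^n · Id`. -/
def piSc (n : ℤ) : GG p N := scalarGL p N (pU p ^ n)

/-- Invertible diagonal matrices. -/
def diagGL (d : Fin N → ℚ_[p]ˣ) : GG p N where
  val := Matrix.diagonal fun i => (d i : ℚ_[p])
  inv := Matrix.diagonal fun i => (((d i)⁻¹ : ℚ_[p]ˣ) : ℚ_[p])
  val_inv := by
    rw [Matrix.diagonal_mul_diagonal]
    simp
  inv_val := by
    rw [Matrix.diagonal_mul_diagonal]
    simp

/-- extend `a ∈ ℤ^{N-1}` by `0` in the last coordinate. -/
def expo (a : Fin (N - 1) → ℤ) : Fin N → ℤ :=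
  fun i => if h : (i : ℕ) < N - 1 then a ⟨i, h⟩ else 0

/-- `t_a = diag(ϖ^{a_1}, …, ϖ^{a_{N-1}}, 1)`. -/
def tGL (a : Fin (N - 1) → ℤ) : GG p N :=
  diagGL p N fun i => pU p ^ (expo N a i)

/-- The permutation matrix of `σ` (with `permGL σ · e_j = e_{σ j}`, so that
`permGL` is a group homomorphism). -/
def permGL (σ : Equiv.Perm (Fin N)) : GG p N where
  val := (σ⁻¹).permMatrix ℚ_[p]
  inv := σ.permMatrix ℚ_[p]
  val_inv := by
    show ((σ⁻¹).toPEquiv.toMatrix : Matrix (Fin N) (Fin N) ℚ_[p]) * σ.toPEquiv.toMatrix = 1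
    rw [← PEquiv.toMatrix_trans, ← Equiv.toPEquiv_trans]
    simp only [Equiv.self_trans_symm, Equiv.symm_trans_self, Equiv.Perm.inv_def]
    rw [Equiv.toPEquiv_refl, PEquiv.toMatrix_refl]
  inv_val := by
    show (σ.toPEquiv.toMatrix : Matrix (Fin N) (Fin N) ℚ_[p]) * (σ⁻¹).toPEquiv.toMatrix = 1
    rw [← PEquiv.toMatrix_trans, ← Equiv.toPEquiv_trans]
    simp only [Equiv.self_trans_symm, Equiv.symm_trans_self, Equiv.Perm.inv_def]
    rw [Equiv.toPEquiv_refl, PEquiv.toMatrix_refl]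

/-- `ω t_a`. -/
def wS (σ : Equiv.Perm (Fin N)) (a : Fin (N - 1) → ℤ) : GG p N :=
  permGL p N σ * tGL p N a

/-- The permutation `ω₂` (as a matrix: first row block `(0, I_{N-1})`, last row `(1,0,…,0)`). -/
def w2 : Equiv.Perm (Fin N) := (finRotate N)⁻¹

/-- `γ = ω₂ · diag(ϖ, I_{N-1})`. -/
def gammaGL : GG p N :=
  permGL p N (w2 N) * tGL p N fun i => if (i : ℕ) = 0 then 1 else 0

/-- `S_ω = {a ∈ ℤ^{N-1} : (ω t_a) I (ω t_a)⁻¹ ∩ K ⊆ I}`. -/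
def Sset (σ : Equiv.Perm (Fin N)) : Set (Fin (N - 1) → ℤ) :=
  {a | ∀ g ∈ Iset p N,
    wS p N σ a * g * (wS p N σ a)⁻¹ ∈ Kset p N →
    wS p N σ a * g * (wS p N σ a)⁻¹ ∈ Iset p N}

/-- The unit of `k_F^×` attached to a nonzero element of `k_F` (junk value `1` at `0`). -/
def unitOf (x : ZMod p) : (ZMod p)ˣ :=
  if h : x = 0 then 1 else Units.mk0 x h

/-- The diagonal of the reduction of `m`, as an `N`-tuple of units of `k_F`. -/
def diagOf (m : MM p N) : Fin N → (ZMod p)ˣ :=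
  fun i => unitOf p ((redM p N m : Matrix (Fin N) (Fin N) (ZMod p)) i i)

/-- The transformation rule for functions in `H_{IZ}(χ)`, where the character `χ` of `I`
is given by the character `ξ` of the torus `(k_F^×)^N` through the diagonal of the
reduction, extended to `IZ` by `χ(ϖ) = 1`. -/
def HTransf (ξ : (Fin N → (ZMod p)ˣ) →* (kb p)ˣ) (φ : GG p N → kb p) : Prop :=
  ∀ (n₁ n₂ : ℤ) (m₁ m₂ : MM p N), m₁ ∈ Ipre p N → m₂ ∈ Ipre p N → ∀ g : GG p N,
    φ (piSc p N n₁ * iotaM p N m₁ * g * (piSc p N n₂ * iotaM p N m₂)) =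
      (ξ (diagOf p N m₁) : kb p) * (ξ (diagOf p N m₂) : kb p) * φ g

/-- `φ` is supported on the double coset `IZ x I`. -/
def SuppDouble (φ : GG p N → kb p) (x : GG p N) : Prop :=
  ∀ g : GG p N, φ g ≠ 0 → ∃ (n : ℤ) (m₁ m₂ : MM p N), m₁ ∈ Ipre p N ∧ m₂ ∈ Ipre p N ∧
    g = piSc p N n * iotaM p N m₁ * x * iotaM p N m₂

/-- Membership in `H_{IZ}(χ)`: the transformation rule together with support in
finitely many double cosets `IZ g I`. -/
def HMem (ξ : (Fin N → (ZMod p)ˣ) →* (kb p)ˣ) (φ : GG p N → kb p) : Prop :=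
  HTransf p N ξ φ ∧
  ∃ S : Finset (GG p N), ∀ g : GG p N, φ g ≠ 0 →
    ∃ s ∈ S, ∃ (n : ℤ) (m₁ m₂ : MM p N), m₁ ∈ Ipre p N ∧ m₂ ∈ Ipre p N ∧
      g = piSc p N n * iotaM p N m₁ * s * iotaM p N m₂

section Rep

variable {V : Type} [AddCommGroup V] [Module (kb p) V]

/-- `σ` (here `ρ`) is irreducible. -/
def IsIrred (ρ : Representation (kb p) (Gk p N) V) : Prop :=
  (∃ v : V, v ≠ 0) ∧
  ∀ W : Submodule (kb p) V, (∀ g v, v ∈ W → ρ g v ∈ W) → W = ⊥ ∨ W = ⊤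

/-- Membership in the compact induction `ind_{KZ}^G σ`: left `KZ`-equivariance
(where `ϖ` acts trivially), support in finitely many cosets `KZ g`, and smoothness. -/
def IndMem (ρ : Representation (kb p) (Gk p N) V) (f : GG p N → V) : Prop :=
  (∀ (n : ℤ) (m : MM p N) (g : GG p N),
      f (piSc p N n * iotaM p N m * g) = ρ (redM p N m) (f g)) ∧
  (∃ S : Finset (GG p N), ∀ g : GG p N, f g ≠ 0 →
      ∃ s ∈ S, ∃ (n : ℤ) (m : MM p N), g = piSc p N n * iotaM p N m * s) ∧
  (∃ U : Subgroup (GG p N), IsOpen (U : Set (GG p N)) ∧ ∀ u ∈ U, ∀ g, f (g * u) = f g)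

/-- `f` is invariant under right translation by `I_1`. -/
def IsI1Inv (f : GG p N → V) : Prop :=
  ∀ u ∈ I1set p N, ∀ g, f (g * u) = f g

/-- The defining property of the standard function `f_{ω,a}`: an `I_1`-invariant member of
`ind_{KZ}^G σ` supported on `KZ t_a I_1` with value `v₀` at `ω t_a`. -/
def IsStd (ρ : Representation (kb p) (Gk p N) V) (v₀ : V)
    (σp : Equiv.Perm (Fin N)) (a : Fin (N - 1) → ℤ) (f : GG p N → V) : Prop :=
  IndMem p N ρ f ∧ IsI1Inv p N f ∧
  (∀ g : GG p N, f g ≠ 0 → ∃ (n : ℤ) (m : MM p N) (u : GG p N), u ∈ I1set p N ∧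
      g = piSc p N n * iotaM p N m * tGL p N a * u) ∧
  f (wS p N σp a) = v₀

/-- `R` is a set of representatives for `I_1/(I_1 ∩ g⁻¹ I_1 g)`. -/
def IsRepSet (g : GG p N) (R : Finset (GG p N)) : Prop :=
  (↑R ⊆ I1set p N) ∧
  ∀ x ∈ I1set p N, ∃! r : GG p N, r ∈ R ∧
    (r⁻¹ * x ∈ I1set p N ∧ g * (r⁻¹ * x) * g⁻¹ ∈ I1set p N)

/-- The Hecke operator: `f|T_g = ∑_{r} (r g⁻¹)·f`, where `(h·f)(x) = f(xh)`. -/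
def hk (g : GG p N) (R : Finset (GG p N)) (f : GG p N → V) : GG p N → V :=
  fun x => ∑ r ∈ R, f (x * r * g⁻¹)

end Rep

theorem wS_mul_mul_inv_apply (σ : Equiv.Perm (Fin N)) (a : Fin (N - 1) → ℤ) (g : GG p N)
    (x y : Fin N) :
    (wS p N σ a * g * (wS p N σ a)⁻¹ : GG p N) x y =
      (p : ℚ_[p]) ^ (expo N a (σ⁻¹ x) - expo N a (σ⁻¹ y)) * g (σ⁻¹ x) (σ⁻¹ y) := by
  have hp : (p : ℚ_[p]) ≠ 0 := Nat.cast_ne_zero.mpr (Fact.out : p.Prime).ne_zero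
  have key : (wS p N σ a * g * (wS p N σ a)⁻¹ : GG p N) =
      permGL p N σ * (tGL p N a * g * (tGL p N a)⁻¹) * (permGL p N σ)⁻¹ := by
    simp only [wS]; group
  have h1 (M : Matrix (Fin N) (Fin N) ℚ_[p]) :
      (permGL p N σ).val * M * (permGL p N σ)⁻¹.val = M.submatrix ⇑σ⁻¹ ⇑σ⁻¹ := by
    change (σ⁻¹).toPEquiv.toMatrix * M * σ.toPEquiv.toMatrix = _
    rw [PEquiv.toMatrix_toPEquiv_mul, PEquiv.mul_toMatrix_toPEquiv]
    rfl
  have h2 : (tGL p N a * g * (tGL p N a)⁻¹ : GG p N).val =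
      Matrix.diagonal (fun i => (p : ℚ_[p]) ^ expo N a i) * g.val *
        Matrix.diagonal (fun i => ((p : ℚ_[p]) ^ expo N a i)⁻¹) := by
    change Matrix.diagonal (fun i => ((pU p ^ expo N a i : ℚ_[p]ˣ) : ℚ_[p])) * g.val *
      Matrix.diagonal (fun i => (((pU p ^ expo N a i)⁻¹ : ℚ_[p]ˣ) : ℚ_[p])) = _
    simp [pU]
  rw [key, Units.val_mul, Units.val_mul, h1, h2, Matrix.submatrix_apply,
    Matrix.mul_diagonal, Matrix.diagonal_mul, zpow_sub₀ hp]
  ring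

theorem iotaM_apply (m : MM p N) (i j : Fin N) : iotaM p N m i j = ((m i j : ℤ_[p]) : ℚ_[p]) :=
  rfl

theorem redM_apply_eq_zero_iff (m : MM p N) (i j : Fin N) :
    redM p N m i j = 0 ↔ ‖(m i j : ℤ_[p])‖ < 1 := by
  change PadicInt.toZMod (m i j) = 0 ↔ _
  rw [← RingHom.mem_ker, PadicInt.ker_toZMod, IsLocalRing.mem_maximalIdeal,
    PadicInt.mem_nonunits]

/-- The elementary matrix `1 + c E_{ij}` as an element of `GL_N(O_F)`. -/
def transvectionGL (i j : Fin N) (h : i ≠ j) (c : ℤ_[p]) : MM p N where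
  val := Matrix.transvection i j c
  inv := Matrix.transvection i j (-c)
  val_inv := by rw [Matrix.transvection_mul_transvection_same _ _ h]; simp
  inv_val := by rw [Matrix.transvection_mul_transvection_same _ _ h]; simp

theorem transvectionGL_apply (i j : Fin N) (h : i ≠ j) (c : ℤ_[p]) (x y : Fin N) :
    transvectionGL p N i j h c x y =
      (if x = y then 1 else 0) + if i = x ∧ j = y then c else 0 := by
  change (1 + Matrix.single i j c) x y = _
  rw [Matrix.add_apply, Matrix.one_apply, Matrix.single_apply]

theorem mem_Sset_of_lex (σ : Equiv.Perm (Fin N)) (a : Fin (N - 1) → ℤ)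
    (h : ∀ x y, x < y → expo N a (σ⁻¹ x) < expo N a (σ⁻¹ y) ∨
      expo N a (σ⁻¹ x) = expo N a (σ⁻¹ y) ∧ σ⁻¹ x < σ⁻¹ y) :
    a ∈ Sset p N σ := by
  rintro _ ⟨g, hg, rfl⟩ ⟨m, hm⟩
  refine ⟨m, fun i j hji => ?_, hm⟩
  rw [redM_apply_eq_zero_iff, PadicInt.norm_def, ← iotaM_apply, hm, wS_mul_mul_inv_apply,
    norm_mul, iotaM_apply, ← PadicInt.norm_def]
  rcases h j i hji with hlt | ⟨heq, hlt⟩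
  · refine mul_lt_one_of_nonneg_of_lt_one_left (norm_nonneg _) ?_ (PadicInt.norm_le_one _)
    rw [Padic.norm_p_zpow]
    exact zpow_lt_one_of_neg₀ (by exact_mod_cast (Fact.out : p.Prime).one_lt) (by omega)
  · rw [heq, sub_self, zpow_zero, norm_one, one_mul]
    exact (redM_apply_eq_zero_iff p N g _ _).1 (hg _ _ hlt)

theorem not_lex_of_mem_Sset (σ : Equiv.Perm (Fin N)) (a : Fin (N - 1) → ℤ)
    (ha : a ∈ Sset p N σ) {x y : Fin N} (hxy : x < y) :
    ¬ (expo N a (σ⁻¹ y) < expo N a (σ⁻¹ x) ∨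
      expo N a (σ⁻¹ y) = expo N a (σ⁻¹ x) ∧ σ⁻¹ y < σ⁻¹ x) := by
  intro h
  have hp : (p : ℚ_[p]) ≠ 0 := Nat.cast_ne_zero.mpr (Fact.out : p.Prime).ne_zero
  have hne : σ⁻¹ y ≠ σ⁻¹ x := fun e => hxy.ne' (σ⁻¹.injective e)
  obtain ⟨k, hk⟩ : ∃ k : ℕ, (k : ℤ) = expo N a (σ⁻¹ x) - expo N a (σ⁻¹ y) :=
    ⟨_, Int.toNat_of_nonneg (by omega)⟩
  have hI : transvectionGL p N _ _ hne ((p : ℤ_[p]) ^ k) ∈ Ipre p N := by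
    intro i j hji
    rw [redM_apply_eq_zero_iff, transvectionGL_apply, if_neg hji.ne', zero_add]
    split_ifs with hij
    · obtain ⟨rfl, rfl⟩ := hij
      have hk0 : k ≠ 0 := by
        rcases h with h | h
        · omega
        · exact absurd h.2 hji.not_gt
      rw [norm_pow]
      exact pow_lt_one₀ (norm_nonneg _) (PadicInt.norm_lt_one_iff_dvd _ |>.2 dvd_rfl) hk0
    · simp
  have hconj : wS p N σ a * iotaM p N (transvectionGL p N _ _ hne ((p : ℤ_[p]) ^ k)) *
      (wS p N σ a)⁻¹ = iotaM p N (transvectionGL p N y x hxy.ne' 1) := by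
    ext i j
    rw [wS_mul_mul_inv_apply, iotaM_apply, iotaM_apply, transvectionGL_apply,
      transvectionGL_apply]
    simp only [EmbeddingLike.apply_eq_iff_eq]
    by_cases hij : i = j
    · subst hij
      have : ¬ (y = i ∧ x = i) := fun e => hxy.ne' (e.1.trans e.2.symm)
      simp [this]
    · by_cases hyx : y = i ∧ x = j
      · obtain ⟨rfl, rfl⟩ := hyx
        simp only [hij, and_self, if_true, if_false, zero_add]
        push_cast
        rw [← zpow_natCast, hk, ← zpow_add₀ hp]
        simp
      · simp [hij, hyx]
  obtain ⟨m, hm, hmeq⟩ := ha _ ⟨_, hI, rfl⟩ ⟨_, hconj.symm⟩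
  have hentry : (m y x : ℤ_[p]) = 1 := by
    have := congrArg (fun g : GG p N => g y x) (hmeq.trans hconj)
    simp only [iotaM_apply, transvectionGL_apply, if_neg hxy.ne', and_self, if_true,
      zero_add] at this
    exact Subtype.ext (by simpa using this)
  have := (redM_apply_eq_zero_iff p N m y x).1 (hm y x hxy)
  rw [hentry, norm_one] at this
  exact lt_irrefl _ this

theorem mem_Sset_iff (σ : Equiv.Perm (Fin N)) (a : Fin (N - 1) → ℤ) :
    a ∈ Sset p N σ ↔ σ⁻¹ = Tuple.sort (expo N a) := by
  rw [Tuple.eq_sort_iff]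
  constructor
  · intro ha
    refine ⟨fun x y hxy => ?_, fun x y hxy he => ?_⟩
    · rcases hxy.eq_or_lt with rfl | hlt
      · exact le_rfl
      · exact not_lt.1 fun h => not_lex_of_mem_Sset p N σ a ha hlt (Or.inl h)
    · have hle := not_lt.1 fun h => not_lex_of_mem_Sset p N σ a ha hxy (Or.inr ⟨he.symm, h⟩)
      exact lt_of_le_of_ne hle fun e => hxy.ne (σ⁻¹.injective e)
  · rintro ⟨hmono, hties⟩
    refine mem_Sset_of_lex p N σ a fun x y hxy => ?_
    rcases (hmono hxy.le).lt_or_eq with h | h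
    · exact Or.inl h
    · exact Or.inr ⟨h, hties x y hxy h⟩

/-- `ℤ^{N-1}` is the disjoint union of the sets `S_ω`. -/
theorem stmt3 (p : ℕ) [Fact p.Prime] (n : ℕ) (a : Fin (n + 2) → ℤ) :
    ∃! ω : Equiv.Perm (Fin (n + 3)), a ∈ Sset p (n + 3) ω := by
  refine ⟨(Tuple.sort (expo (n + 3) a))⁻¹, ?_, fun ω hω => ?_⟩
  · exact (mem_Sset_iff p (n + 3) _ a).2 (inv_inv _)
  · rw [← (mem_Sset_iff p (n + 3) ω a).1 hω, inv_inv]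

end IH
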